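/- Let P be a program and P* = P_trans ∪ {{y_x} ← {t_x} : x, y ∈ at(P)}. For M ⊆ at(P) let M_P = M ∪ {x̄ : x ∈ at(P) \ M} and M' = M_P ∪ ⋃_{x ∈ M} (at(P) ∪ {t})_x. Then M ∈ AS(P) if and only if M' ∈ AS(P*). Moreover, every answer set of P* is of the form M' for some M ⊆ at(P). -/

import Mathlib

open Classical

noncomputable section

/-- A rule of a disjunctive logic program: head, positive body, negative body. -/
structure Rule (A : Type*) where
  head : Finset A
  bodyP : Finset A
  bodyN : Finset A
  deriving DecidableEq

/-- A program is a finite set of rules. -/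
abbrev Program (A : Type*) := Finset (Rule A)

variable {A : Type*} [DecidableEq A]

/-- The atoms occurring in a program. -/
def atoms (P : Program A) : Finset A := P.sup (fun r => r.head ∪ r.bodyP ∪ r.bodyN)

/-- An interpretation `I` satisfies a rule `r` iff `(H(r) ∪ B⁻(r)) ∩ I ≠ ∅` or `B⁺(r) \ I ≠ ∅`. -/
def satR (I : Set A) (r : Rule A) : Prop :=
  (∃ a ∈ r.head ∪ r.bodyN, a ∈ I) ∨ (∃ a ∈ r.bodyP, a ∉ I)

/-- `I` is a model of `P` iff it satisfies every rule of `P`. -/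
def isModel (I : Set A) (P : Program A) : Prop := ∀ r ∈ P, satR I r

/-- The Gelfond-Lifschitz reduct `P^I`. -/
def reduct (P : Program A) (I : Set A) : Program A :=
  (P.filter (fun r => ∀ a ∈ r.bodyN, a ∉ I)).image (fun r => ⟨r.head, r.bodyP, ∅⟩)

/-- `I` is an inclusion-minimal model of `P`. -/
def isMinModel (I : Set A) (P : Program A) : Prop :=
  isModel I P ∧ ∀ J ⊆ I, isModel J P → J = I

/-- `I` is an answer set of `P` iff `I` is a minimal model of the reduct `P^I`. -/
def isAnswerSet (I : Set A) (P : Program A) : Prop := isMinModel I (reduct P I)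

/-- The collection of answer sets of `P`. -/
def AS (P : Program A) : Set (Set A) := {M | isAnswerSet M P}

/-- Dual-Horn: every rule has at most one positive body atom and empty negative body. -/
def dualHorn (P : Program A) : Prop := ∀ r ∈ P, r.bodyP.card ≤ 1 ∧ r.bodyN = ∅

/-- Dual-normal: every rule is a constraint or has at most one positive body atom. -/
def dualNormal (P : Program A) : Prop := ∀ r ∈ P, r.head = ∅ ∨ r.bodyP.card ≤ 1

/-- Normal: every rule has at most one head atom. -/
def normal (P : Program A) : Prop := ∀ r ∈ P, r.head.card ≤ 1

/-- The proper rules (non-constraints) of `P`. -/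
def properPart (P : Program A) : Program A := P.filter (fun r => r.head ≠ ∅)

/-- The constraints of `P`. -/
def constraintPart (P : Program A) : Program A := P.filter (fun r => r.head = ∅)

/-- `P[t]`: replace each rule with empty positive body by one whose positive body is `{t}`. -/
def progT (P : Program A) (t : A) : Program A :=
  P.image (fun r => if r.bodyP = ∅ then ⟨r.head, {t}, r.bodyN⟩ else r)

/-- The elimination sets `E_i` computed from `P[t]` (for `P` dual-Horn). -/
def E (P : Program A) (t : A) : ℕ → Set A
  | 0 => ∅
  | (i+1) => {b | ∃ r ∈ progT P t, r.bodyP = {b} ∧ ↑r.head ⊆ E P t i}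

/-- The program `P_{M,m}`. -/
def pmm (P : Program A) (M : Set A) (m : A) : Program A :=
  reduct (properPart P) M ∪
    ((atoms P).filter (fun b => b ∉ M)).image (fun b => ⟨∅, {b}, ∅⟩) ∪
    {⟨∅, {m}, ∅⟩}

/- Atoms of the translated program: `Sum.inl a` is the original atom `a`,
`Sum.inr (Sum.inl x)` is the fresh atom `x̄`, and `Sum.inr (Sum.inr (y?, x))` is the fresh
atom `y_x` (with `y? = some y`) resp. `t_x` (with `y? = none`). -/
abbrev TA (A : Type*) := A ⊕ (A ⊕ (Option A × A))

/-- The original atom `a`. -/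
def orig (a : A) : TA A := Sum.inl a

/-- The fresh atom `x̄`. -/
def bar (x : A) : TA A := Sum.inr (Sum.inl x)

/-- The fresh atom `y_x` (`sub (some y) x`) resp. `t_x` (`sub none x`). -/
def sub (y : Option A) (x : A) : TA A := Sum.inr (Sum.inr (y, x))

/-- The program `P_x = { B⁺(r)_x ← H(r)_x, not B⁻(r) : r ∈ (P_r)[t] }`:
heads and positive bodies of the rules of `(P_r)[t]` are swapped and their atoms renamed
with subscript `x`; negative bodies keep the original atoms. -/
def Px (P : Program A) (x : A) : Program (TA A) :=
  (properPart P).image (fun r =>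
    ⟨if r.bodyP = ∅ then {sub none x} else r.bodyP.image (fun y => sub (some y) x),
     r.head.image (fun y => sub (some y) x),
     r.bodyN.image orig⟩)

/-- `P_xor = { {x} ← ∅, not {x̄} ; {x̄} ← ∅, not {x} : x ∈ at(P) }`. -/
def Pxor (P : Program A) : Program (TA A) :=
  (atoms P).image (fun x => ⟨{orig x}, ∅, {bar x}⟩) ∪
  (atoms P).image (fun x => ⟨{bar x}, ∅, {orig x}⟩)

/-- `P_aux = { {x_x} ← ∅, not {x̄} : x ∈ at(P) } ∪ { {y_x} ← ∅, not {x̄, y} : x, y ∈ at(P) }`. -/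
def Paux (P : Program A) : Program (TA A) :=
  (atoms P).image (fun x => ⟨{sub (some x) x}, ∅, {bar x}⟩) ∪
  ((atoms P) ×ˢ (atoms P)).image (fun p => ⟨{sub (some p.2) p.1}, ∅, {bar p.1, orig p.2}⟩)

/-- `P_diag = P_xor ∪ P_aux ∪ ⋃_{x ∈ at(P)} P_x`. -/
def Pdiag (P : Program A) : Program (TA A) :=
  Pxor P ∪ Paux P ∪ (atoms P).biUnion (fun x => Px P x)

/-- `P_mod = { ∅ ← B⁺(r), not (H(r) ∪ B⁻(r)) : r ∈ P }`. -/
def Pmod (P : Program A) : Program (TA A) :=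
  P.image (fun r => ⟨∅, r.bodyP.image orig, (r.head ∪ r.bodyN).image orig⟩)

/-- `P_true = { ∅ ← {x}, not {t_x} : x ∈ at(P) }`. -/
def Ptrue (P : Program A) : Program (TA A) :=
  (atoms P).image (fun x => ⟨∅, {orig x}, {sub none x}⟩)

/-- The translated program `P_trans = P_diag ∪ P_mod ∪ P_true`. -/
def Ptrans (P : Program A) : Program (TA A) := Pdiag P ∪ Pmod P ∪ Ptrue P

/-- The program `P_x^M ∪ {{x_x} ← ∅} ∪ {{y_x} ← ∅ : y ∈ at(P) \ M}`, where the reduct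
of `P_x` is taken relative to `M` (whose atoms are original atoms). -/
def PxM (P : Program A) (M : Set A) (x : A) : Program (TA A) :=
  reduct (Px P x) (orig '' M) ∪ {⟨{sub (some x) x}, ∅, ∅⟩} ∪
    ((atoms P).filter (fun y => y ∉ M)).image (fun y => ⟨{sub (some y) x}, ∅, ∅⟩)

/-- `P* = P_trans ∪ { {y_x} ← {t_x} : x, y ∈ at(P) }`. -/
def Pstar (P : Program A) : Program (TA A) :=
  Ptrans P ∪
    ((atoms P) ×ˢ (atoms P)).image (fun p => ⟨{sub (some p.2) p.1}, {sub none p.1}, ∅⟩)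

/-- `M_P = M ∪ {x̄ : x ∈ at(P) \ M}`. -/
def MPset (P : Program A) (M : Set A) : Set (TA A) :=
  orig '' M ∪ bar '' ((↑(atoms P) : Set A) \ M)

/-- `M' = M_P ∪ ⋃_{x ∈ M} (at(P) ∪ {t})_x`. -/
def Mprime (P : Program A) (M : Set A) : Set (TA A) :=
  MPset P M ∪ {z : TA A | ∃ x ∈ M, z = sub none x ∨ ∃ y ∈ atoms P, z = sub (some y) x}

lemma isModel_reduct_iff {B : Type*} [DecidableEq B] (P : Program B) (I J : Set B) :
    isModel J (reduct P I) ↔ ∀ r ∈ P, (∀ a ∈ r.bodyN, a ∉ I) →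
      (∃ a ∈ r.head, a ∈ J) ∨ (∃ a ∈ r.bodyP, a ∉ J) := by
  unfold isModel reduct satR
  constructor
  · intro h r hr hn
    have := h ⟨r.head, r.bodyP, ∅⟩ (Finset.mem_image.2 ⟨r, Finset.mem_filter.2 ⟨hr, hn⟩, rfl⟩)
    simpa using this
  · intro h r hr
    obtain ⟨r', hr', rfl⟩ := Finset.mem_image.1 hr
    obtain ⟨h1, h2⟩ := Finset.mem_filter.1 hr'
    simpa using h r' h1 h2

lemma mem_atoms_of (P : Program A) (r : Rule A) (hr : r ∈ P) (a : A)
    (ha : a ∈ r.head ∨ a ∈ r.bodyP ∨ a ∈ r.bodyN) : a ∈ atoms P := by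
  unfold atoms
  rw [Finset.mem_sup]
  exact ⟨r, hr, by simp only [Finset.mem_union]; tauto⟩

/-- Semantic characterisation of models of the reduct of `P*`. -/
structure StarModel (P : Program A) (S J : Set (TA A)) : Prop where
  xor1 : ∀ x ∈ atoms P, bar x ∉ S → orig x ∈ J
  xor2 : ∀ x ∈ atoms P, orig x ∉ S → bar x ∈ J
  aux1 : ∀ x ∈ atoms P, bar x ∉ S → sub (some x) x ∈ J
  aux2 : ∀ x ∈ atoms P, ∀ y ∈ atoms P, bar x ∉ S → orig y ∉ S → sub (some y) x ∈ J
  px : ∀ x ∈ atoms P, ∀ r ∈ P, r.head ≠ ∅ → (∀ a ∈ r.bodyN, orig a ∉ S) →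
    (∀ a ∈ r.head, sub (some a) x ∈ J) →
    (r.bodyP = ∅ ∧ sub none x ∈ J) ∨ ∃ b ∈ r.bodyP, sub (some b) x ∈ J
  modl : ∀ r ∈ P, (∀ a ∈ r.head, orig a ∉ S) → (∀ a ∈ r.bodyN, orig a ∉ S) →
    ∃ b ∈ r.bodyP, orig b ∉ J
  tru : ∀ x ∈ atoms P, sub none x ∉ S → orig x ∉ J
  sat : ∀ x ∈ atoms P, ∀ y ∈ atoms P, sub none x ∈ J → sub (some y) x ∈ J

lemma starModel_iff (P : Program A) (S J : Set (TA A)) :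
    isModel J (reduct (Pstar P) S) ↔ StarModel P S J := by
  rw [isModel_reduct_iff]
  constructor
  · intro h
    refine ⟨?_, ?_, ?_, ?_, ?_, ?_, ?_, ?_⟩
    · intro x hx hb
      have := h ⟨{orig x}, ∅, {bar x}⟩ (by
        unfold Pstar Ptrans Pdiag Pxor
        simp only [Finset.mem_union]
        exact Or.inl (Or.inl (Or.inl (Or.inl (Or.inl (Or.inl (Finset.mem_image_of_mem _ hx)))))))
      simpa [hb] using this
    · intro x hx hb
      have := h ⟨{bar x}, ∅, {orig x}⟩ (by
        unfold Pstar Ptrans Pdiag Pxor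
        simp only [Finset.mem_union]
        exact Or.inl (Or.inl (Or.inl (Or.inl (Or.inl (Or.inr (Finset.mem_image_of_mem _ hx)))))))
      simpa [hb] using this
    · intro x hx hb
      have := h ⟨{sub (some x) x}, ∅, {bar x}⟩ (by
        unfold Pstar Ptrans Pdiag Paux
        simp only [Finset.mem_union]
        exact Or.inl (Or.inl (Or.inl (Or.inl (Or.inr (Or.inl (Finset.mem_image_of_mem _ hx)))))))
      simpa [hb] using this
    · intro x hx y hy hb ho
      have := h ⟨{sub (some y) x}, ∅, {bar x, orig y}⟩ (by
        unfold Pstar Ptrans Pdiag Paux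
        simp only [Finset.mem_union]
        exact Or.inl (Or.inl (Or.inl (Or.inl (Or.inr (Or.inr (Finset.mem_image.2
          ⟨(x, y), Finset.mem_product.2 ⟨hx, hy⟩, rfl⟩)))))))
      simpa [hb, ho] using this
    · intro x hx r hr hne hn hh
      have := h ⟨if r.bodyP = ∅ then {sub none x} else r.bodyP.image (fun y => sub (some y) x),
          r.head.image (fun y => sub (some y) x), r.bodyN.image orig⟩ (by
        unfold Pstar Ptrans Pdiag
        simp only [Finset.mem_union]
        exact Or.inl (Or.inl (Or.inl (Or.inr (Finset.mem_biUnion.2 ⟨x, hx, Finset.mem_image.2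
          ⟨r, Finset.mem_filter.2 ⟨hr, hne⟩, rfl⟩⟩)))))
      specialize this (by simpa using hn)
      rcases this with ⟨a, ha, haJ⟩ | ⟨a, ha, haJ⟩
      · by_cases hb : r.bodyP = ∅
        · simp only [hb, if_true, Finset.mem_singleton] at ha
          exact Or.inl ⟨hb, ha ▸ haJ⟩
        · simp only [hb, if_false, Finset.mem_image] at ha
          obtain ⟨b, hb1, rfl⟩ := ha
          exact Or.inr ⟨b, hb1, haJ⟩
      · obtain ⟨b, hb1, rfl⟩ := Finset.mem_image.1 ha
        exact absurd (hh b hb1) haJ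
    · intro r hr hh hn
      have := h ⟨∅, r.bodyP.image orig, (r.head ∪ r.bodyN).image orig⟩ (by
        unfold Pstar Ptrans
        simp only [Finset.mem_union]
        exact Or.inl (Or.inl (Or.inr (Finset.mem_image_of_mem _ hr))))
      specialize this (by
        intro a ha
        obtain ⟨b, hb, rfl⟩ := Finset.mem_image.1 ha
        rcases Finset.mem_union.1 hb with hb | hb
        exacts [hh b hb, hn b hb])
      simpa using this
    · intro x hx hb
      have := h ⟨∅, {orig x}, {sub none x}⟩ (by
        unfold Pstar Ptrans
        simp only [Finset.mem_union]
        exact Or.inl (Or.inr (Finset.mem_image_of_mem _ hx)))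
      simpa [hb] using this
    · intro x hx y hy ht
      have := h ⟨{sub (some y) x}, {sub none x}, ∅⟩ (by
        unfold Pstar
        simp only [Finset.mem_union]
        exact Or.inr (Finset.mem_image.2 ⟨(x, y), Finset.mem_product.2 ⟨hx, hy⟩, rfl⟩))
      simpa [ht] using this
  · intro h r hr hn
    unfold Pstar Ptrans Pdiag Pxor Paux Pmod Ptrue at hr
    simp only [Finset.mem_union] at hr
    rcases hr with ((((((hr | hr) | (hr | hr)) | hr) | hr) | hr) | hr)
    · obtain ⟨x, hx, rfl⟩ := Finset.mem_image.1 hr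
      simpa using h.xor1 x hx (by simpa using hn)
    · obtain ⟨x, hx, rfl⟩ := Finset.mem_image.1 hr
      simpa using h.xor2 x hx (by simpa using hn)
    · obtain ⟨x, hx, rfl⟩ := Finset.mem_image.1 hr
      simpa using h.aux1 x hx (by simpa using hn)
    · obtain ⟨⟨x, y⟩, hx, rfl⟩ := Finset.mem_image.1 hr
      obtain ⟨hx, hy⟩ := Finset.mem_product.1 hx
      simpa using h.aux2 x hx y hy (hn _ (by simp)) (hn _ (by simp))
    · obtain ⟨x, hx, hr⟩ := Finset.mem_biUnion.1 hr
      obtain ⟨r, hr', rfl⟩ := Finset.mem_image.1 hr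
      obtain ⟨hr, hne⟩ := Finset.mem_filter.1 hr'
      by_cases hh : ∀ a ∈ r.head, sub (some a) x ∈ J
      · left
        rcases h.px x hx r hr hne (by simpa using hn) hh with ⟨h1, h2⟩ | ⟨b, h1, h2⟩
        · exact ⟨_, by simp [h1], h2⟩
        · refine ⟨sub (some b) x, ?_, h2⟩
          rw [if_neg (Finset.ne_empty_of_mem h1)]
          exact Finset.mem_image_of_mem (fun y => sub (some y) x) h1
      · right
        push Not at hh
        obtain ⟨a, ha, haJ⟩ := hh
        exact ⟨_, Finset.mem_image_of_mem (fun y => sub (some y) x) ha, haJ⟩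
    · obtain ⟨r, hr', rfl⟩ := Finset.mem_image.1 hr
      right
      obtain ⟨b, hb, hbJ⟩ := h.modl r hr'
        (fun a ha => hn _ (Finset.mem_image_of_mem _ (Finset.mem_union_left _ ha)))
        (fun a ha => hn _ (Finset.mem_image_of_mem _ (Finset.mem_union_right _ ha)))
      exact ⟨_, Finset.mem_image_of_mem _ hb, hbJ⟩
    · obtain ⟨x, hx, rfl⟩ := Finset.mem_image.1 hr
      simpa using h.tru x hx (by simpa using hn)
    · obtain ⟨⟨x, y⟩, hx, rfl⟩ := Finset.mem_image.1 hr
      obtain ⟨hx, hy⟩ := Finset.mem_product.1 hx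
      have := h.sat x hx y hy
      simp only [Finset.mem_singleton, exists_eq_left]
      tauto

lemma orig_mem_Mprime (P : Program A) (M : Set A) (x : A) :
    orig x ∈ Mprime P M ↔ x ∈ M := by
  simp [Mprime, MPset, orig, bar, sub]

lemma bar_mem_Mprime (P : Program A) (M : Set A) (x : A) :
    bar x ∈ Mprime P M ↔ x ∈ atoms P ∧ x ∉ M := by
  simp [Mprime, MPset, orig, bar, sub]

lemma none_mem_Mprime (P : Program A) (M : Set A) (x : A) :
    sub none x ∈ Mprime P M ↔ x ∈ M := by
  simp [Mprime, MPset, orig, bar, sub]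

lemma some_mem_Mprime (P : Program A) (M : Set A) (x y : A) :
    sub (some y) x ∈ Mprime P M ↔ x ∈ M ∧ y ∈ atoms P := by
  simp [Mprime, MPset, orig, bar, sub]

lemma ta_subset {S T : Set (TA A)} (h1 : ∀ x, orig x ∈ S → orig x ∈ T)
    (h2 : ∀ x, bar x ∈ S → bar x ∈ T) (h3 : ∀ x, sub none x ∈ S → sub none x ∈ T)
    (h4 : ∀ x y, sub (some y) x ∈ S → sub (some y) x ∈ T) : S ⊆ T := by
  rintro (a | a | ⟨_ | y, x⟩) h
  exacts [h1 a h, h2 a h, h3 x h, h4 x y h]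

lemma form_of_answerSet (P : Program A) (S : Set (TA A)) (hS : isAnswerSet S (Pstar P)) :
    ∃ M₀ : Set A, M₀ ⊆ ↑(atoms P) ∧ S = Mprime P M₀ := by
  obtain ⟨h1, hmin⟩ := hS
  rw [starModel_iff] at h1
  have key := hmin (S ∩ Mprime P {x | x ∈ atoms P ∧ orig x ∈ S}) Set.inter_subset_left
  have hx : ∀ x ∈ atoms P, bar x ∉ S → orig x ∈ S := h1.xor1
  refine ⟨{x | x ∈ atoms P ∧ orig x ∈ S}, fun x hx => hx.1, ?_⟩
  apply Set.Subset.antisymm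
  · rw [← Set.inter_eq_left]
    apply key
    rw [starModel_iff]
    refine ⟨?_, ?_, ?_, ?_, ?_, ?_, ?_, ?_⟩
    · intro x hxa hb
      exact ⟨h1.xor1 x hxa hb, (orig_mem_Mprime ..).2 ⟨hxa, h1.xor1 x hxa hb⟩⟩
    · intro x hxa hb
      exact ⟨h1.xor2 x hxa hb, (bar_mem_Mprime ..).2 ⟨hxa, fun h => hb h.2⟩⟩
    · intro x hxa hb
      exact ⟨h1.aux1 x hxa hb, (some_mem_Mprime ..).2 ⟨⟨hxa, hx x hxa hb⟩, hxa⟩⟩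
    · intro x hxa y hya hb ho
      exact ⟨h1.aux2 x hxa y hya hb ho, (some_mem_Mprime ..).2 ⟨⟨hxa, hx x hxa hb⟩, hya⟩⟩
    · intro x hxa r hr hne hn hh
      obtain ⟨a, ha⟩ := Finset.nonempty_iff_ne_empty.2 hne
      have hxM := ((some_mem_Mprime ..).1 (hh a ha).2).1
      rcases h1.px x hxa r hr hne hn (fun a ha => (hh a ha).1) with ⟨h2, h3⟩ | ⟨b, h2, h3⟩
      · exact Or.inl ⟨h2, h3, (none_mem_Mprime ..).2 hxM⟩
      · exact Or.inr ⟨b, h2, h3, (some_mem_Mprime ..).2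
          ⟨hxM, mem_atoms_of P r hr b (Or.inr (Or.inl h2))⟩⟩
    · intro r hr hh hn
      obtain ⟨b, hb, hb2⟩ := h1.modl r hr hh hn
      exact ⟨b, hb, fun h => hb2 h.1⟩
    · intro x hxa hb h
      exact h1.tru x hxa hb h.1
    · intro x hxa y hya h
      exact ⟨h1.sat x hxa y hya h.1,
        (some_mem_Mprime ..).2 ⟨(none_mem_Mprime ..).1 h.2, hya⟩⟩
  · have ht : ∀ x ∈ atoms P, orig x ∈ S → sub none x ∈ S := by
      intro x hxa ho
      by_contra hc
      exact h1.tru x hxa hc ho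
    apply ta_subset
    · intro x h
      exact ((orig_mem_Mprime ..).1 h).2
    · intro x h
      obtain ⟨h2, h3⟩ := (bar_mem_Mprime ..).1 h
      exact h1.xor2 x h2 fun h4 => h3 ⟨h2, h4⟩
    · intro x h
      obtain ⟨h2, h3⟩ := (none_mem_Mprime ..).1 h
      exact ht x h2 h3
    · intro x y h
      obtain ⟨⟨h2, h3⟩, h4⟩ := (some_mem_Mprime ..).1 h
      exact h1.sat x h2 y h4 (ht x h2 h3)

lemma star_of_answerSet (P : Program A) (M : Set A) (hM : M ⊆ ↑(atoms P))
    (h : isAnswerSet M P) : isAnswerSet (Mprime P M) (Pstar P) := by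
  obtain ⟨hm, hmin⟩ := h
  rw [isModel_reduct_iff] at hm
  refine ⟨?_, ?_⟩
  · rw [starModel_iff]
    refine ⟨?_, ?_, ?_, ?_, ?_, ?_, ?_, ?_⟩ <;>
      simp only [orig_mem_Mprime, bar_mem_Mprime, none_mem_Mprime, some_mem_Mprime]
    · tauto
    · tauto
    · tauto
    · tauto
    · intro x hx r hr hne hn hh
      obtain ⟨a, ha⟩ := Finset.nonempty_iff_ne_empty.2 hne
      by_cases hb : r.bodyP = ∅
      · exact Or.inl ⟨hb, (hh a ha).1⟩
      · obtain ⟨b, hb⟩ := Finset.nonempty_iff_ne_empty.2 hb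
        exact Or.inr ⟨b, hb, (hh a ha).1, mem_atoms_of P r hr b (Or.inr (Or.inl hb))⟩
    · intro r hr hh hn
      rcases hm r hr hn with ⟨a, ha, haM⟩ | h
      · exact absurd haM (hh a ha)
      · exact h
    · tauto
    · tauto
  · intro J hJ hJm
    rw [starModel_iff] at hJm
    obtain ⟨k1, k2, k3, k4, k5, k6, k7, k8⟩ := hJm
    simp only [orig_mem_Mprime, bar_mem_Mprime, none_mem_Mprime] at k1 k2 k3 k4 k5 k6 k7
    have ht : ∀ x ∈ M, sub none x ∈ J := by
      intro x hx
      by_contra hc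
      have hxa : x ∈ atoms P := hM hx
      have hN := hmin {y | y ∈ M ∧ sub (some y) x ∉ J} (fun y hy => hy.1) (by
        rw [isModel_reduct_iff]
        intro r hr hn
        by_cases hne : r.head = ∅
        · right
          rcases hm r hr hn with ⟨a, ha, haM⟩ | ⟨b, hb, hbM⟩
          · simp [hne] at ha
          · exact ⟨b, hb, fun h => hbM h.1⟩
        · by_contra hcon
          push Not at hcon
          obtain ⟨c1, c2⟩ := hcon
          rcases k5 x hxa r hr hne hn (by
            intro a ha
            by_cases haM : a ∈ M
            · by_contra h3
              exact c1 a ha ⟨haM, h3⟩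
            · exact k4 x hxa a (mem_atoms_of P r hr a (Or.inl ha)) (by tauto) haM)
            with ⟨_, h⟩ | ⟨b, hb, h⟩
          · exact hc h
          · exact (c2 b hb).2 h)
      have hx2 : x ∈ {y | y ∈ M ∧ sub (some y) x ∉ J} := by rw [hN]; exact hx
      exact hx2.2 (k3 x hxa (by tauto))
    apply Set.Subset.antisymm hJ
    apply ta_subset <;>
      simp only [orig_mem_Mprime, bar_mem_Mprime, none_mem_Mprime, some_mem_Mprime]
    · intro x hx
      exact k1 x (hM hx) (by tauto)
    · intro x hx
      exact k2 x hx.1 hx.2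
    · exact ht
    · intro x y h
      exact k8 x (hM h.1) y h.2 (ht x h.1)

lemma answerSet_of_star (P : Program A) (M : Set A) (hM : M ⊆ ↑(atoms P))
    (h : isAnswerSet (Mprime P M) (Pstar P)) : isAnswerSet M P := by
  obtain ⟨hm, hmin⟩ := h
  rw [starModel_iff] at hm
  have hmod := hm.modl
  simp only [orig_mem_Mprime] at hmod
  refine ⟨?_, ?_⟩
  · rw [isModel_reduct_iff]
    intro r hr hn
    by_cases hh : ∃ a ∈ r.head, a ∈ M
    · exact Or.inl hh
    · push Not at hh
      exact Or.inr (hmod r hr hh hn)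
  · intro N hN hNm
    rw [isModel_reduct_iff] at hNm
    apply Set.Subset.antisymm hN
    intro x hx
    by_contra hxN
    set D : Set (TA A) := {z | z = sub none x ∨ ∃ y ∈ N, z = sub (some y) x} with hD
    have d1 : ∀ a, orig a ∉ D := by intro a; simp [hD, orig, sub]
    have d2 : ∀ a, bar a ∉ D := by intro a; simp [hD, bar, sub]
    have d3 : ∀ a, sub none a ∈ D ↔ a = x := by intro a; simp [hD, sub]
    have d4 : ∀ a b, sub (some b) a ∈ D ↔ a = x ∧ b ∈ N := by
      intro a b; simp [hD, sub]; aesop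
    have hJ := hmin (Mprime P M \ D) Set.sdiff_subset (by
      rw [starModel_iff]
      refine ⟨?_, ?_, ?_, ?_, ?_, ?_, ?_, ?_⟩ <;>
        simp only [orig_mem_Mprime, bar_mem_Mprime, none_mem_Mprime, some_mem_Mprime,
          Set.mem_sdiff, d1, d2, d3, d4]
      · tauto
      · tauto
      · intro z hz h
        refine ⟨⟨by tauto, hz⟩, ?_⟩
        rintro ⟨rfl, h⟩
        exact hxN h
      · intro z hz y hy h1 h2
        exact ⟨⟨by tauto, hy⟩, fun h => h2 (hN h.2)⟩
      · intro z hz r hr hne hn hh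
        obtain ⟨a, ha⟩ := Finset.nonempty_iff_ne_empty.2 hne
        have hzM := (hh a ha).1.1
        by_cases hzx : z = x
        · right
          rcases hNm r hr hn with ⟨c, hc, hcN⟩ | ⟨b, hb, hbN⟩
          · exact absurd ⟨hzx, hcN⟩ (hh c hc).2
          · exact ⟨b, hb, ⟨hzM, mem_atoms_of P r hr b (Or.inr (Or.inl hb))⟩, fun h => hbN h.2⟩
        · by_cases hb : r.bodyP = ∅
          · exact Or.inl ⟨hb, hzM, hzx⟩
          · obtain ⟨b, hb⟩ := Finset.nonempty_iff_ne_empty.2 hb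
            exact Or.inr ⟨b, hb, ⟨hzM, mem_atoms_of P r hr b (Or.inr (Or.inl hb))⟩,
              fun h => hzx h.1⟩
      · intro r hr hh hn
        obtain ⟨b, hb, h⟩ := hmod r hr hh hn
        exact ⟨b, hb, fun h2 => h h2.1⟩
      · tauto
      · tauto)
    have : sub none x ∈ Mprime P M \ D := by
      rw [hJ]; exact (none_mem_Mprime ..).2 hx
    exact this.2 ((d3 x).2 rfl)

/-- `M ∈ AS(P)` iff `M' ∈ AS(P*)`; moreover every answer set of `P*` is of
the form `M'` for some `M ⊆ at(P)`. -/
theorem answerSet_Pstar_correspondence (P : Program A) (M : Set A)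
    (hM : M ⊆ ↑(atoms P)) :
    (isAnswerSet M P ↔ isAnswerSet (Mprime P M) (Pstar P)) ∧
    (∀ S : Set (TA A), isAnswerSet S (Pstar P) →
      ∃ M₀ : Set A, M₀ ⊆ ↑(atoms P) ∧ S = Mprime P M₀) := by
  exact ⟨⟨star_of_answerSet P M hM, answerSet_of_star P M hM⟩,
    fun S hS => form_of_answerSet P S hS⟩
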